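/- arXiv:2504.09728 — 5 statements merged into one kernel-verified Lean document; each statement's English description precedes it below -/
import Mathlib

section
/- For every n ≥ 1, the row vector v₀ · P^{n-1}, where v₀ = (1/2, 1/2, 0), equals (1/3 + (-1)^{n+1}/(3·2ⁿ), 1/3 + (-1)^{n+1}/(3·2ⁿ), 1/3 − (-1)^{n+1}/(3·2^{n-1})). Equivalently, the distribution of the n-th awakening X_n of the repeated Sleeping Beauty experiment is given by this explicit formula. -/
open Matrix

/-- The Sleeping Beauty transition matrix. -/
noncomputable def P : Matrix (Fin 3) (Fin 3) ℝ := !![1/2, 1/2, 0; 0, 0, 1; 1/2, 1/2, 0]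

/-- The initial distribution of the Sleeping Beauty chain. -/
noncomputable def v₀ : Fin 3 → ℝ := ![1/2, 1/2, 0]

/-- Explicit formula for the distribution of the n-th awakening:
v₀ · P^(n-1) = (1/3 + (-1)^(n+1)/(3·2ⁿ), 1/3 + (-1)^(n+1)/(3·2ⁿ),
1/3 − (-1)^(n+1)/(3·2^(n-1))). -/
theorem sb_distribution_formula (n : ℕ) (hn : 1 ≤ n) :
    Matrix.vecMul v₀ (P ^ (n - 1)) =
      ![1/3 + (-1 : ℝ) ^ (n + 1) / (3 * 2 ^ n),
        1/3 + (-1 : ℝ) ^ (n + 1) / (3 * 2 ^ n),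
        1/3 - (-1 : ℝ) ^ (n + 1) / (3 * 2 ^ (n - 1))] := by
  obtain ⟨m, rfl⟩ := Nat.exists_eq_add_of_le' hn
  rw [Nat.add_sub_cancel]
  clear hn
  induction m with
  | zero =>
    rw [pow_zero, Matrix.vecMul_one]
    ext i
    fin_cases i <;> norm_num [v₀]
  | succ k ih =>
    rw [pow_succ, ← Matrix.vecMul_vecMul, ih]
    ext i
    fin_cases i <;> simp [P, Matrix.vecMul, dotProduct, Fin.sum_univ_three, pow_succ] <;>
      field_simp <;> ring
end

section
/- For every n ≥ 2, the n-th power of the Sleeping Beauty transition matrix P is given explicitly as follows: rows 0 (M_H) and 2 (Tu) of Pⁿ both equal f(n) and row 1 (M_T) of Pⁿ equals f(n−1), where f(k) = (1/3 + (-1)^{k+1}/(3·2ᵏ), 1/3 + (-1)^{k+1}/(3·2ᵏ), 1/3 − (-1)^{k+1}/(3·2^{k-1})). -/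
open Matrix

/-- The row vector f(k) from the explicit formula for powers of P. -/
noncomputable def f (k : ℕ) : Fin 3 → ℝ :=
  ![1/3 + (-1 : ℝ) ^ (k + 1) / (3 * 2 ^ k),
    1/3 + (-1 : ℝ) ^ (k + 1) / (3 * 2 ^ k),
    1/3 - (-1 : ℝ) ^ (k + 1) / (3 * 2 ^ (k - 1))]

/-- Left multiplication by `P` replaces rows `0` and `2` by the average of rows `0` and `1`, and
row `1` by row `2`. -/
theorem P_mul_rows (A : Matrix (Fin 3) (Fin 3) ℝ) :
    (P * A) 0 = (1 / 2 : ℝ) • (A 0 + A 1) ∧ (P * A) 1 = A 2 ∧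
      (P * A) 2 = (1 / 2 : ℝ) • (A 0 + A 1) := by
  refine ⟨?_, ?_, ?_⟩ <;> ext i <;> simp [P, Matrix.mul_apply, Fin.sum_univ_succ, mul_add]

/-- From `f 3` on, each vector `f k` is the average of the two preceding ones. -/
theorem f_add_three (k : ℕ) : f (k + 3) = (1 / 2 : ℝ) • (f (k + 2) + f (k + 1)) := by
  ext i
  fin_cases i <;> simp [f, pow_succ] <;> field_simp <;> ring

theorem P_pow_add_two (k : ℕ) :
    (P ^ (k + 2)) 0 = f (k + 2) ∧ (P ^ (k + 2)) 1 = f (k + 1) ∧ (P ^ (k + 2)) 2 = f (k + 2) := by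
  induction k with
  | zero =>
    obtain ⟨h0, h1, h2⟩ := P_mul_rows P
    rw [zero_add, pow_two, h0, h1, h2, show P 2 = ![1 / 2, 1 / 2, 0] from rfl]
    refine ⟨?_, ?_, ?_⟩ <;> ext i <;> fin_cases i <;> norm_num [P, f]
  | succ k ih =>
    obtain ⟨h0, h1, h2⟩ := P_mul_rows (P ^ (k + 2))
    rw [show k + 1 + 2 = (k + 2) + 1 from rfl, pow_succ', h0, h1, h2, ih.1, ih.2.1, ih.2.2,
      f_add_three]
    exact ⟨rfl, rfl, rfl⟩

/-- Explicit formula for Pⁿ, n ≥ 2: rows 0 and 2 equal f(n) and row 1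
equals f(n−1). -/
theorem sb_power_formula (n : ℕ) (hn : 2 ≤ n) :
    (P ^ n) 0 = f n ∧ (P ^ n) 1 = f (n - 1) ∧ (P ^ n) 2 = f n := by
  obtain ⟨k, rfl⟩ := Nat.exists_eq_add_of_le' hn
  exact P_pow_add_two k
end

section
/- The sequence of row vectors v₀ · Pⁿ, where v₀ = (1/2, 1/2, 0), converges to (1/3, 1/3, 1/3) as n → ∞. In particular, the probability that the n-th awakening of the repeated Sleeping Beauty experiment is a Heads–Monday awakening converges to 1/3. -/
open Matrix Filter

/-- Closed form of the distribution after `n` steps. -/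
theorem vecMul_v₀_P_pow (n : ℕ) :
    Matrix.vecMul v₀ (P ^ n) =
      ![1/3 + 1/6 * (-1/2) ^ n, 1/3 + 1/6 * (-1/2) ^ n, 1/3 - 1/3 * (-1/2) ^ n] := by
  induction n with
  | zero =>
    ext i
    fin_cases i <;> norm_num [v₀]
  | succ k ih =>
    rw [pow_succ, ← Matrix.vecMul_vecMul, ih]
    ext i
    fin_cases i <;> simp [P, Matrix.vecMul, dotProduct, Fin.sum_univ_three, pow_succ] <;> ring

/-- v₀ · Pⁿ → (1/3, 1/3, 1/3); in particular the probability that the n-th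
awakening is a Heads–Monday awakening (coordinate 0) tends to 1/3. -/
theorem sb_convergence :
    Tendsto (fun n : ℕ => Matrix.vecMul v₀ (P ^ n)) atTop
      (nhds ![1/3, 1/3, 1/3]) ∧
    Tendsto (fun n : ℕ => Matrix.vecMul v₀ (P ^ n) 0) atTop (nhds (1/3)) := by
  have hr : Tendsto (fun n : ℕ => (-1/2 : ℝ) ^ n) atTop (nhds 0) :=
    tendsto_pow_atTop_nhds_zero_of_abs_lt_one (by norm_num [abs_lt])
  have hx : Tendsto (fun n : ℕ => (1/3 + 1/6 * (-1/2) ^ n : ℝ)) atTop (nhds (1/3)) := by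
    simpa using (hr.const_mul (1/6 : ℝ)).const_add (1/3 : ℝ)
  have hc : Tendsto (fun n : ℕ => (1/3 - 1/3 * (-1/2) ^ n : ℝ)) atTop (nhds (1/3)) := by
    simpa using (hr.const_mul (1/3 : ℝ)).const_sub (1/3 : ℝ)
  have h : Tendsto (fun n : ℕ => Matrix.vecMul v₀ (P ^ n)) atTop (nhds ![1/3, 1/3, 1/3]) := by
    simp_rw [vecMul_v₀_P_pow]
    refine tendsto_pi_nhds.2 fun i => ?_
    fin_cases i
    exacts [hx, hx, hc]
  exact ⟨h, tendsto_pi_nhds.1 h 0⟩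
end

section
/- For every row vector v ∈ ℝ³ with nonnegative entries summing to 1, the sequence v · Pⁿ converges to (1/3, 1/3, 1/3) as n → ∞; i.e., the asymptotic distribution of the Sleeping Beauty Markov chain is (1/3, 1/3, 1/3) regardless of the initial distribution. -/
open Matrix Filter

theorem vecMul_P (a b c : ℝ) : ![a, b, c] ᵥ* P = ![(a + c) / 2, (a + c) / 2, b] := by
  ext i
  fin_cases i <;> simp [P, vecMul, dotProduct, Fin.sum_univ_three] <;> ring

/-- The eigenvalues of `P` are `1`, `0` and `-1/2`; after one step only the eigenvalue `-1/2`
contributes to the deviation from the uniform distribution. -/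
theorem vecMul_P_pow_succ (v : Fin 3 → ℝ) (hsum : ∑ i, v i = 1) (n : ℕ) :
    v ᵥ* P ^ (n + 1) =
      (![1/3, 1/3, 1/3] : Fin 3 → ℝ) +
        ((-1/2 : ℝ) ^ n) • (((v 0 + v 2) / 2 - 1/3) • ![1, 1, -2]) := by
  rw [Fin.sum_univ_three] at hsum
  induction n with
  | zero =>
    have hv : v = ![v 0, v 1, v 2] := by
      ext i
      fin_cases i <;> rfl
    rw [zero_add, pow_one, hv, vecMul_P]
    ext i
    fin_cases i <;> simp <;> linarith
  | succ n ih =>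
    rw [pow_succ, ← vecMul_vecMul, ih]
    simp only [smul_cons, smul_empty, cons_add_cons, empty_add_empty, smul_eq_mul, vecMul_P]
    ext i
    fin_cases i <;> simp <;> ring

/-- For every probability row vector v, the sequence v · Pⁿ converges to
(1/3, 1/3, 1/3): the asymptotic distribution does not depend on the initial
distribution. -/
theorem sb_ergodic_convergence (v : Fin 3 → ℝ)
    (hnonneg : ∀ i, 0 ≤ v i) (hsum : ∑ i, v i = 1) :
    Tendsto (fun n : ℕ => Matrix.vecMul v (P ^ n)) atTop
      (nhds ![1/3, 1/3, 1/3]) := by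
  rw [← tendsto_add_atTop_iff_nat 1]
  simp_rw [vecMul_P_pow_succ v hsum]
  have hpow : Tendsto (fun n : ℕ => (-1/2 : ℝ) ^ n) atTop (nhds 0) :=
    tendsto_pow_atTop_nhds_zero_of_abs_lt_one (by norm_num [abs_lt])
  simpa using (hpow.smul_const (((v 0 + v 2) / 2 - 1/3) • ![(1 : ℝ), 1, -2])).const_add
    (![1/3, 1/3, 1/3] : Fin 3 → ℝ)
end

section
/- The matrix powers Pⁿ converge, as n → ∞, to the 3×3 matrix all of whose entries equal 1/3. -/
open Matrix Filter

theorem P_pow_succ (n : ℕ) :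
    P ^ (n + 1) = (Matrix.of fun _ _ : Fin 3 => (1/3 : ℝ)) +
      (-1/2 : ℝ) ^ n • (P - Matrix.of fun _ _ : Fin 3 => (1/3 : ℝ)) := by
  induction n with
  | zero => simp
  | succ n ih =>
    rw [pow_succ, ih]
    ext i j
    simp only [Matrix.mul_apply, Fin.sum_univ_three, Matrix.add_apply, Matrix.smul_apply,
      Matrix.sub_apply, Matrix.of_apply (fun _ _ : Fin 3 => (1/3 : ℝ)), smul_eq_mul]
    fin_cases i <;> fin_cases j <;> simp [P] <;> ring

/-- The matrix powers Pⁿ converge to the matrix whose entries all equal 1/3. -/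
theorem sb_power_convergence :
    Tendsto (fun n : ℕ => P ^ n) atTop
      (nhds (Matrix.of fun _ _ : Fin 3 => (1/3 : ℝ))) := by
  rw [← tendsto_add_atTop_iff_nat 1]
  simp only [P_pow_succ]
  have h : Tendsto (fun n : ℕ => (-1/2 : ℝ) ^ n) atTop (nhds 0) :=
    tendsto_pow_atTop_nhds_zero_of_abs_lt_one (by norm_num [abs_lt])
  simpa using (h.smul_const (P - Matrix.of fun _ _ : Fin 3 => (1/3 : ℝ))).const_add
    (Matrix.of fun _ _ : Fin 3 => (1/3 : ℝ))
end
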